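/- arXiv:2511.23363 — 4 statements merged into one kernel-verified Lean document; each statement's English description precedes it below -/
import Mathlib

section
/- Let (G,+) and (H,⊕) be finite groups, let k ≥ 1, let σ̄ = (σ_1,…,σ_k) ∈ {+1,−1}^k be a fixed sign sequence, and let f : G → H be a function with ε_f < 1/8. Then the fraction of tuples x = (x_1,…,x_k) ∈ G^k for which ⊕_{i=1}^{k} σ_i f(x_i) ≠ f(Σ_{i=1}^{k} σ_i x_i) is at least min{ (k−3)·ε_f/3 , 1/6 }. -/
/-- Apply a sign to a group element: `true` is `+` (identity), `false` is `-` (inverse). -/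
def applySign {G : Type*} [Group G] (b : Bool) (g : G) : G := if b then g else g⁻¹

/-- Signed product `σ₁x₁ ⋯ σₖxₖ`, taken in increasing index order. -/
def sProd {G : Type*} [Group G] {k : ℕ} (σ : Fin k → Bool) (x : Fin k → G) : G :=
  (List.ofFn fun i => applySign (σ i) (x i)).prod

/-- Relative Hamming distance between two functions on a finite domain. -/
noncomputable def hdist {G H : Type*} [Fintype G] (f g : G → H) : ℝ :=
  (Nat.card {x : G // f x ≠ g x} : ℝ) / (Fintype.card G : ℝ)

/-- Distance from `f` to the set of group homomorphisms `G →* H`. -/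
noncomputable def epsF {G H : Type*} [Fintype G] [Group G] [Group H] (f : G → H) : ℝ :=
  sInf (Set.range fun h : G →* H => hdist f ⇑h)

lemma applySign_eq_iff {G : Type*} [Group G] (b : Bool) (g g' : G) :
    applySign b g = applySign b g' ↔ g = g' := by
  cases b <;> simp [applySign]

lemma map_applySign {G H : Type*} [Group G] [Group H] (h : G →* H) (b : Bool) (g : G) :
    h (applySign b g) = applySign b (h g) := by
  cases b <;> simp [applySign]

lemma applySign_bijective {G : Type*} [Group G] (b : Bool) :
    Function.Bijective (applySign b : G → G) := by
  refine ⟨fun g g' => (applySign_eq_iff b g g').1, fun g => ⟨applySign b g, ?_⟩⟩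
  cases b <;> simp [applySign]

lemma sProd_succ {G : Type*} [Group G] {m : ℕ} (σ : Fin (m + 1) → Bool) (x : Fin (m + 1) → G) :
    sProd σ x = applySign (σ 0) (x 0) * sProd (fun i => σ i.succ) (fun i => x i.succ) := by
  simp [sProd, List.ofFn_succ]

lemma sum_fin_succ_fun {G : Type*} [Fintype G] {m : ℕ} (F : (Fin (m + 1) → G) → ℝ) :
    ∑ x, F x = ∑ g : G, ∑ t : Fin m → G, F (Fin.cons g t) := by
  rw [← Fintype.sum_prod_type']
  exact (Fintype.sum_equiv (Fin.consEquiv fun _ => G) _ _ fun _ => rfl).symm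

/-- The signed product of a nonempty uniform tuple is uniform. -/
lemma sum_comp_sProd {G : Type*} [Group G] [Fintype G] {m : ℕ} (σ : Fin (m + 1) → Bool)
    (F : G → ℝ) : ∑ x, F (sProd σ x) = (Fintype.card G : ℝ) ^ m * ∑ g, F g := by
  rw [sum_fin_succ_fun, Finset.sum_comm]
  have key (t : Fin m → G) : ∑ g, F (sProd σ (Fin.cons g t : Fin (m + 1) → G)) = ∑ g, F g := by
    simp only [sProd_succ, Fin.cons_zero, Fin.cons_succ]
    exact Fintype.sum_bijective _
      ((Group.mulRight_bijective _).comp (applySign_bijective (σ 0))) _ _ fun _ => rfl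
  simp [key]

open Classical in
/-- The bias of the event that the signed product of the values of `f` agrees with that of a
homomorphism `h` is at most the `m`-th power of the bias of agreement of `f` and `h`. -/
lemma sum_sign_sProd_le {G H : Type*} [Group G] [Group H] [Fintype G] (f : G → H) (h : G →* H)
    (hpos : 0 ≤ ∑ g, if f g ≠ h g then (-1 : ℝ) else 1) (m : ℕ) (σ : Fin m → Bool) :
    (∑ x : Fin m → G, if sProd σ (fun i => f (x i)) ≠ h (sProd σ x) then (-1 : ℝ) else 1) ≤
      (∑ g, if f g ≠ h g then (-1 : ℝ) else 1) ^ m := by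
  induction m with
  | zero => simp [sProd]
  | succ m ih =>
    rw [sum_fin_succ_fun, pow_succ']
    refine le_trans ?_ (mul_le_mul_of_nonneg_left (ih fun i => σ i.succ) hpos)
    rw [Finset.sum_mul_sum]
    refine Finset.sum_le_sum fun g _ => Finset.sum_le_sum fun t _ => ?_
    simp only [sProd_succ, Fin.cons_zero, Fin.cons_succ, map_mul, map_applySign]
    by_cases h1 : f g = h g
    · simp [h1]
    · by_cases h2 : sProd (fun i => σ i.succ) (fun i => f (t i)) =
          h (sProd (fun i => σ i.succ) t)
      · simp [h1, h2, applySign_eq_iff]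
      · simp only [ne_eq, h1, h2, not_false_eq_true, if_true]
        split_ifs <;> norm_num

lemma exists_hdist_eq_epsF {G H : Type*} [Group G] [Group H] [Fintype G] [Fintype H]
    (f : G → H) : ∃ h : G →* H, hdist f h = epsF f := by
  have : Finite (G →* H) := DFunLike.finite _
  exact (Set.range_nonempty _).csInf_mem (Set.finite_range fun h : G →* H => hdist f h)

lemma min_le_of_pow_bound {k : ℕ} {e p : ℝ} (h0 : 0 ≤ e) (h8 : e < 1 / 8)
    (hp : 1 - 2 * (p + e) ≤ (1 - 2 * e) ^ k) : min (((k : ℝ) - 3) * e / 3) (1 / 6) ≤ p := by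
  set t : ℝ := k * e with ht
  have ht0 : 0 ≤ t := by positivity
  have hb : 1 + 2 * t ≤ (1 + 2 * e) ^ k := by
    have := one_add_mul_le_pow (a := 2 * e) (by linarith) k
    linarith
  have hq0 : 0 ≤ (1 - 2 * e) ^ k := pow_nonneg (by linarith) k
  have hprod : (1 - 2 * e) ^ k * (1 + 2 * e) ^ k ≤ 1 := by
    rw [← mul_pow]
    exact pow_le_one₀ (by nlinarith) (by nlinarith)
  have hq : (1 - 2 * e) ^ k * (1 + 2 * t) ≤ 1 :=
    (mul_le_mul_of_nonneg_left hb hq0).trans hprod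
  have hmain : t ≤ (p + e) * (1 + 2 * t) := by nlinarith
  by_cases hc : t ≤ 1
  · refine min_le_of_left_le ?_
    have : ((k : ℝ) - 3) * e / 3 = t / 3 - e := by rw [ht]; ring
    nlinarith
  · refine min_le_of_right_le ?_
    push Not at hc
    nlinarith

theorem stmt2 {G H : Type*} [Group G] [Group H] [Fintype G] [Fintype H]
    (k : ℕ) (hk : 1 ≤ k) (σ : Fin k → Bool)
    (f : G → H) (hclose : epsF f < 1 / 8) :
    min (((k : ℝ) - 3) * epsF f / 3) (1 / 6) ≤
      (Nat.card {x : Fin k → G //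
          sProd σ (fun i => f (x i)) ≠ f (sProd σ x)} : ℝ) /
        (Nat.card (Fin k → G) : ℝ) := by
  classical
  obtain ⟨h, hh⟩ := exists_hdist_eq_epsF f
  obtain ⟨m, rfl⟩ : ∃ m, k = m + 1 := ⟨k - 1, by omega⟩
  have hn : (0 : ℝ) < Fintype.card G := by exact_mod_cast Fintype.card_pos
  have hB : (∑ g, if f g ≠ h g then (1 : ℝ) else 0) = epsF f * Fintype.card G := by
    rw [← hh, hdist, div_mul_cancel₀ _ hn.ne', Nat.card_eq_fintype_card, Fintype.card_subtype,
      Finset.sum_boole]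
  have sign_eq (P : Prop) [Decidable P] : (if P then (-1 : ℝ) else 1) =
      1 - 2 * if P then (1 : ℝ) else 0 := by
    split_ifs <;> norm_num
  have hS : (∑ g, if f g ≠ h g then (-1 : ℝ) else 1) = (1 - 2 * epsF f) * Fintype.card G := by
    simp_rw [sign_eq, Finset.sum_sub_distrib, ← Finset.mul_sum, hB]
    simp
    ring
  have h0 : 0 ≤ epsF f := by rw [← hh, hdist]; positivity
  have hle := sum_sign_sProd_le f h (by rw [hS]; exact mul_nonneg (by linarith) hn.le) (m + 1) σ
  rw [hS, mul_pow] at hle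
  have hy := sum_comp_sProd σ fun g => if f g ≠ h g then (1 : ℝ) else 0
  rw [hB] at hy
  have hpt : (∑ x : Fin (m + 1) → G,
      if sProd σ (fun i => f (x i)) ≠ h (sProd σ x) then (1 : ℝ) else 0) ≤
      (∑ x : Fin (m + 1) → G,
        if sProd σ (fun i => f (x i)) ≠ f (sProd σ x) then (1 : ℝ) else 0) +
      ∑ x : Fin (m + 1) → G, if f (sProd σ x) ≠ h (sProd σ x) then (1 : ℝ) else 0 := by
    rw [← Finset.sum_add_distrib]
    refine Finset.sum_le_sum fun x _ => ?_
    by_cases h1 : sProd σ (fun i => f (x i)) = f (sProd σ x)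
    · simp [h1]
    · simp only [ne_eq, h1, not_false_eq_true, if_true]
      split_ifs <;> norm_num
  simp_rw [sign_eq, Finset.sum_sub_distrib, ← Finset.mul_sum] at hle
  refine min_le_of_pow_bound h0 hclose ?_
  have hN : (Nat.card (Fin (m + 1) → G) : ℝ) = (Fintype.card G : ℝ) ^ (m + 1) := by simp
  have hN0 : (0 : ℝ) < (Fintype.card G : ℝ) ^ (m + 1) := by positivity
  have hone : (∑ _x : Fin (m + 1) → G, (1 : ℝ)) = (Fintype.card G : ℝ) ^ (m + 1) := by simp
  rw [hone] at hle
  rw [hN, Nat.card_eq_fintype_card, Fintype.card_subtype, ← Finset.sum_boole]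
  refine le_of_mul_le_mul_right ?_ hN0
  refine le_trans ?_ hle
  rw [sub_mul, mul_assoc, add_mul, div_mul_cancel₀ _ hN0.ne']
  have : epsF f * (Fintype.card G : ℝ) ^ (m + 1) =
      (Fintype.card G : ℝ) ^ m * (epsF f * Fintype.card G) := by ring
  linarith
end

section
/- Let (G,+) and (H,⊕) be finite groups, let σ̄ = (σ_1,…,σ_k) ∈ {+1,−1}^k be a fixed sign sequence, let f : G → H be a function, let g : G → H be a homomorphism with dist(f,g) = ε_f, and assume ε_f > 0. Then for every k ≥ 1 with k ≤ 1/ε_f, the fraction of tuples x = (x_1,…,x_k) ∈ G^k for which ⊕_{i=1}^{k} σ_i f(x_i) = ⊕_{i=1}^{k} σ_i g(x_i) is at most 1 − k·ε_f/e. -/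
theorem List.eq_at_of_prod_ofFn_eq {M : Type*} [Group M] {k : ℕ} {u v : Fin k → M} (i : Fin k)
    (huv : ∀ j, j ≠ i → u j = v j) (h : (List.ofFn u).prod = (List.ofFn v).prod) :
    u i = v i := by
  induction k with
  | zero => exact i.elim0
  | succ k ih =>
    simp only [List.ofFn_succ, List.prod_cons] at h
    cases i using Fin.cases with
    | zero =>
      have htail : (fun j : Fin k => u j.succ) = fun j => v j.succ :=
        funext fun j => huv _ (Fin.succ_ne_zero j)
      rw [htail] at h
      exact mul_right_cancel h
    | succ i =>
      rw [huv 0 (Fin.succ_ne_zero i).symm] at h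
      exact ih (u := fun j => u j.succ) (v := fun j => v j.succ) i
        (fun j hj => huv _ fun e => hj (Fin.succ_injective _ e)) (mul_left_cancel h)

theorem applySign_injective {M : Type*} [Group M] (b : Bool) :
    Function.Injective (applySign (G := M) b) := by
  intro x y h
  cases b <;> simpa [applySign] using h

theorem sProd_ne_of_ne_at {M : Type*} [Group M] {k : ℕ} (σ : Fin k → Bool) {u v : Fin k → M}
    (i : Fin k) (hi : u i ≠ v i) (huv : ∀ j, j ≠ i → u j = v j) : sProd σ u ≠ sProd σ v :=
  fun h => hi <| applySign_injective (σ i) <|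
    List.eq_at_of_prod_ofFn_eq (u := fun j => applySign (σ j) (u j))
      (v := fun j => applySign (σ j) (v j)) i (fun j hj => by rw [huv j hj]) h

/-- The tuples having exactly one entry in `B` number at least (in fact exactly)
`k * |B| * |Bᶜ| ^ (k - 1)`. -/
theorem Finset.mul_card_mul_card_compl_pow_le {α : Type*} [Fintype α] [DecidableEq α] {k : ℕ}
    (B : Finset α) (S : Finset (Fin k → α))
    (hS : ∀ x i, x i ∈ B → (∀ j, j ≠ i → x j ∉ B) → x ∈ S) :
    k * (B.card * Bᶜ.card ^ (k - 1)) ≤ S.card := by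
  let T : Fin k → Finset (Fin k → α) := fun i =>
    Fintype.piFinset fun j => if j = i then B else Bᶜ
  have hT : ∀ i x, x ∈ T i ↔ x i ∈ B ∧ ∀ j, j ≠ i → x j ∉ B := by
    intro i x
    simp only [T, Fintype.mem_piFinset]
    constructor
    · intro h
      refine ⟨by simpa using h i, fun j hj => by simpa [hj] using h j⟩
    · rintro ⟨h₁, h₂⟩ j
      by_cases hj : j = i
      · subst hj; simpa using h₁
      · simpa [hj] using h₂ j hj
  have hcard : ∀ i, (T i).card = B.card * Bᶜ.card ^ (k - 1) := by
    intro i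
    simp only [T, Fintype.card_piFinset]
    rw [← Finset.mul_prod_erase _ _ (Finset.mem_univ i), if_pos rfl]
    congr 1
    rw [Finset.prod_congr rfl (g := fun _ => Bᶜ.card)
      fun j hj => by rw [if_neg (Finset.ne_of_mem_erase hj)]]
    simp
  have hdisj : ((Finset.univ : Finset (Fin k)) : Set (Fin k)).PairwiseDisjoint T := by
    intro i _ j _ hij
    refine Finset.disjoint_left.2 fun x hi hj => ?_
    exact ((hT j x).1 hj).2 i hij ((hT i x).1 hi).1
  calc k * (B.card * Bᶜ.card ^ (k - 1)) = (Finset.univ.biUnion T).card := by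
        rw [Finset.card_biUnion hdisj]; simp [hcard]
    _ ≤ S.card := Finset.card_le_card fun x hx => by
        obtain ⟨i, -, hi⟩ := Finset.mem_biUnion.1 hx
        exact hS x i ((hT i x).1 hi).1 ((hT i x).1 hi).2

theorem Real.exp_neg_one_le_one_sub_pow {ε : ℝ} (hε : 0 < ε) {k : ℕ} (hk : 1 ≤ k)
    (hkε : k * ε ≤ 1) : Real.exp (-1) ≤ (1 - ε) ^ (k - 1) := by
  obtain ⟨m, rfl⟩ := Nat.exists_eq_add_of_le' hk
  rw [Nat.add_sub_cancel]
  push_cast at hkε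
  rcases Nat.eq_zero_or_pos m with rfl | hm
  · simp
  have hm' : (1 : ℝ) ≤ m := by exact_mod_cast hm
  have hlt : 0 < 1 - ε := by nlinarith
  rw [← Real.exp_log (pow_pos hlt m), Real.log_pow, Real.exp_le_exp]
  have hlog : 1 - (1 - ε)⁻¹ ≤ Real.log (1 - ε) := Real.one_sub_inv_le_log_of_pos hlt
  have hinv : (1 - ε)⁻¹ * m ≤ m + 1 := by
    rw [inv_mul_le_iff₀ hlt]; nlinarith
  nlinarith

theorem stmt3 {G H : Type*} [Group G] [Group H] [Fintype G] [Fintype H]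
    (k : ℕ) (hk : 1 ≤ k) (σ : Fin k → Bool)
    (f : G → H) (g : G →* H)
    (hg : hdist f ⇑g = epsF f) (hpos : 0 < epsF f)
    (hk' : (k : ℝ) ≤ 1 / epsF f) :
    (Nat.card {x : Fin k → G //
        sProd σ (fun i => f (x i)) = sProd σ (fun i => g (x i))} : ℝ) /
      (Nat.card (Fin k → G) : ℝ) ≤ 1 - (k : ℝ) * epsF f / Real.exp 1 := by
  classical
  rw [← hg] at hpos hk' ⊢
  set ε := hdist f ⇑g with hε
  let B : Finset G := Finset.univ.filter fun x => f x ≠ g x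
  let S : Finset (Fin k → G) :=
    Finset.univ.filter fun x => sProd σ (fun i => f (x i)) = sProd σ (fun i => g (x i))
  have hn : (0 : ℝ) < Fintype.card G := by exact_mod_cast Fintype.card_pos
  have hB : (B.card : ℝ) = ε * Fintype.card G := by
    rw [hε, hdist, div_mul_cancel₀ _ hn.ne', Nat.card_eq_fintype_card, Fintype.card_subtype]
  have hBc : (Bᶜ.card : ℝ) = (1 - ε) * Fintype.card G := by
    rw [Finset.card_compl, Nat.cast_sub B.card_le_univ, hB]; ring
  have hcount := Finset.mul_card_mul_card_compl_pow_le B Sᶜ fun x i hi hj => by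
    simp only [S, B, Finset.mem_compl, Finset.mem_filter, Finset.mem_univ, true_and, ne_eq,
      not_not] at hi hj ⊢
    exact sProd_ne_of_ne_at σ i hi hj
  have hSc : (Sᶜ.card : ℝ) = (Fintype.card G : ℝ) ^ k - S.card := by
    rw [Finset.card_compl, Nat.cast_sub S.card_le_univ]; simp
  have hcount' : (k : ℝ) * (B.card * (Bᶜ.card : ℝ) ^ (k - 1)) ≤ Sᶜ.card := by
    exact_mod_cast hcount
  rw [hSc, hB, hBc, mul_pow] at hcount'
  have hpow : (Fintype.card G : ℝ) * (Fintype.card G : ℝ) ^ (k - 1) = (Fintype.card G : ℝ) ^ k :=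
    mul_pow_sub_one (by omega) _
  have hexp := Real.exp_neg_one_le_one_sub_pow hpos hk ((le_div_iff₀ hpos).1 hk')
  have hcardS : Nat.card {x : Fin k → G //
      sProd σ (fun i => f (x i)) = sProd σ (fun i => g (x i))} = S.card := by
    rw [Nat.card_eq_fintype_card, Fintype.card_subtype]
  have hcardG : (Nat.card (Fin k → G) : ℝ) = (Fintype.card G : ℝ) ^ k := by simp
  rw [hcardS, hcardG, div_le_iff₀ (pow_pos hn k), div_eq_mul_inv, ← Real.exp_neg]
  have hmain := mul_le_mul_of_nonneg_left hexp
    (by positivity : 0 ≤ (k : ℝ) * ε * (Fintype.card G : ℝ) ^ k)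
  rw [← hpow] at hmain hcount' ⊢
  linarith
end

section
/- Let (G,+) and (H,⊕) be finite groups, let k ≥ 1, and let f : G → H be any function. Then the fraction of tuples (σ,x) ∈ {+1,−1}^{2k} × G^{2k} for which ⊕_{i=1}^{2k} σ_i f(x_i) ≠ f(Σ_{i=1}^{2k} σ_i x_i) is at least min{ ε_f/2 , 1/10 }. -/
section Indicator

open Classical in
/-- The real-valued indicator of a proposition. -/
noncomputable def ind (P : Prop) : ℝ := if P then 1 else 0

lemma ind_of_true {P : Prop} (h : P) : ind P = 1 := if_pos h

lemma ind_of_false {P : Prop} (h : ¬P) : ind P = 0 := if_neg h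

lemma ind_nonneg (P : Prop) : 0 ≤ ind P := by
  unfold ind; split_ifs <;> norm_num

lemma ind_le_add {P Q R : Prop} (h : P → Q ∨ R) : ind P ≤ ind Q + ind R := by
  unfold ind; split_ifs <;> first | tauto | norm_num

lemma ind_add_le {P Q R : Prop} (hP : P → R) (hQ : Q → R) (hPQ : ¬(P ∧ Q)) :
    ind P + ind Q ≤ ind R := by
  unfold ind; split_ifs <;> first | tauto | norm_num

lemma sum_ind_eq_card {ι : Type*} [Fintype ι] (P : ι → Prop) :
    ∑ i, ind (P i) = (Nat.card {i // P i} : ℝ) := by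
  classical
  simp [ind, Nat.card_eq_fintype_card, Fintype.card_subtype]

lemma exists_le_of_sum_le_card_mul {ι : Type*} [Fintype ι] [Nonempty ι] {F : ι → ℝ} {b : ℝ}
    (h : ∑ i, F i ≤ Fintype.card ι * b) : ∃ i, F i ≤ b := by
  obtain ⟨i, -, hi⟩ := Finset.exists_le_of_sum_le (s := Finset.univ) (f := F)
    (g := fun _ => b) Finset.univ_nonempty (by simpa using h)
  exact ⟨i, hi⟩

/-- Cross collisions of two functions are at most as frequent as self-collisions on average. -/
lemma two_mul_sum_ind_eq_le {ι γ : Type*} [Fintype ι] [Fintype γ] (a b : ι → γ) :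
    2 * ∑ i, ∑ j, ind (a i = b j) ≤
      ∑ i, ∑ j, ind (a i = a j) + ∑ i, ∑ j, ind (b i = b j) := by
  classical
  have key : ∀ u v : ι → γ, ∑ i, ∑ j, ind (u i = v j) =
      ∑ h, (∑ i, ind (u i = h)) * ∑ j, ind (v j = h) := by
    intro u v
    simp_rw [Finset.sum_mul_sum]
    rw [Finset.sum_comm]
    refine Eq.trans ?_ Finset.sum_comm.symm
    rw [Finset.sum_comm]
    refine Finset.sum_congr rfl fun i _ => ?_
    rw [Finset.sum_comm]
    refine Finset.sum_congr rfl fun j _ => ?_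
    rw [Finset.sum_eq_single (v j)]
    · simp [ind]
    · intro h _ hne
      simp [ind, hne.symm]
    · simp
  rw [key, key, key, Finset.mul_sum, ← Finset.sum_add_distrib]
  refine Finset.sum_le_sum fun h _ => ?_
  nlinarith [sq_nonneg ((∑ i, ind (a i = h)) - ∑ j, ind (b j = h))]

end Indicator

section SignedWord

variable {α K : Type*} [Group K]

@[simp]
lemma applySign_not (b : Bool) (g : K) : applySign (!b) g = (applySign b g)⁻¹ := by
  cases b <;> simp [applySign]

@[simp]
lemma applySign_applySign (b : Bool) (g : K) : applySign b (applySign b g) = g := by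
  cases b <;> simp [applySign]

/-- `applySign b` as a permutation of the group. -/
def applySignEquiv (b : Bool) : Equiv.Perm K where
  toFun := applySign b
  invFun := applySign b
  left_inv := applySign_applySign b
  right_inv := applySign_applySign b

/-- The product in `K` of a word of signed letters, each letter being evaluated by `g`. -/
def wordProd (g : α → K) {n : ℕ} (p : Fin n → Bool × α) : K :=
  sProd (fun i => (p i).1) fun i => g (p i).2

lemma wordProd_cons (g : α → K) {n : ℕ} (a : Bool × α) (p : Fin n → Bool × α) :
    wordProd g (Fin.cons a p : Fin (n + 1) → Bool × α) =
      applySign a.1 (g a.2) * wordProd g p := by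
  simp [wordProd, sProd, List.ofFn_succ]

lemma wordProd_append (g : α → K) {m n : ℕ} (p : Fin m → Bool × α) (q : Fin n → Bool × α) :
    wordProd g (Fin.append p q) = wordProd g p * wordProd g q := by
  have h : ∀ {l : ℕ} (r : Fin l → Bool × α),
      wordProd g r = ((List.ofFn r).map fun a => applySign a.1 (g a.2)).prod := by
    intro l r
    rw [List.map_ofFn]
    rfl
  rw [h, h, h, List.ofFn_fin_append, List.map_append, List.prod_append]

/-- The inverse word: reverse the letters and flip the signs. -/
def invWord (n : ℕ) : Equiv.Perm (Fin n → Bool × α) where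
  toFun p i := (!(p i.rev).1, (p i.rev).2)
  invFun p i := (!(p i.rev).1, (p i.rev).2)
  left_inv p := by simp
  right_inv p := by simp

lemma wordProd_invWord (g : α → K) {n : ℕ} (p : Fin n → Bool × α) :
    wordProd g (invWord n p) = (wordProd g p)⁻¹ := by
  unfold wordProd sProd
  rw [List.prod_inv_reverse, List.map_ofFn]
  congr 1
  apply List.ext_getElem
  · simp
  · intro i h₁ h₂
    simp [invWord, Fin.rev]
    rw [List.length_ofFn] at h₁
    have : n - (i + 1) = n - 1 - i := by omega
    simp only [this]

lemma sum_word_succ [Fintype α] {n : ℕ} (F : (Fin (n + 1) → Bool × α) → ℝ) :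
    ∑ p, F p = ∑ b, ∑ x, ∑ q : Fin n → Bool × α, F (Fin.cons (b, x) q) := by
  rw [← (Fin.consEquiv fun _ : Fin (n + 1) => Bool × α).sum_comp, Fintype.sum_prod_type,
    Fintype.sum_prod_type]
  rfl

lemma sum_word_append [Fintype α] {m n : ℕ} (F : (Fin (m + n) → Bool × α) → ℝ) :
    ∑ p, F p = ∑ q : Fin m → Bool × α, ∑ r : Fin n → Bool × α, F (Fin.append q r) := by
  rw [← (Fin.appendEquiv m n).sum_comp, Fintype.sum_prod_type]
  rfl

/-- The product of a nonempty uniformly random signed word is uniformly distributed. -/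
lemma card_mul_sum_wordProd [Fintype K] {n : ℕ} (F : K → ℝ) :
    (Fintype.card K : ℝ) * ∑ p : Fin (n + 1) → Bool × K, F (wordProd id p) =
      Fintype.card (Fin (n + 1) → Bool × K) * ∑ x, F x := by
  have h : ∀ (b : Bool) (q : Fin n → Bool × K),
      ∑ x, F (applySign b x * wordProd id q) = ∑ x, F x := fun b q =>
    Equiv.sum_comp ((applySignEquiv b).trans (Equiv.mulRight (wordProd id q))) F
  have h' : ∑ p : Fin (n + 1) → Bool × K, F (wordProd id p) =
      ∑ _b : Bool, ∑ _q : Fin n → Bool × K, ∑ x, F x := by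
    rw [sum_word_succ]
    refine Finset.sum_congr rfl fun b _ => ?_
    rw [Finset.sum_comm]
    refine Finset.sum_congr rfl fun q _ => ?_
    simp only [wordProd_cons, id]
    exact h b q
  rw [h']
  simp [pow_succ]
  ring

end SignedWord

section HomomorphismTest

variable {G H : Type*} [Group G] [Group H] [Fintype G]

/-- If `f` passes the signed test with failure rate at most `δ`, then every left difference of `f`
is constant up to a set of density at most `2δ`. -/
lemma exists_left_difference {n : ℕ} (f : G → H) {δ : ℝ}
    (hδ : ∑ p : Fin (n + 2) → Bool × G, ind (wordProd f p ≠ f (wordProd id p)) ≤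
      δ * Fintype.card (Fin (n + 2) → Bool × G)) (a : G) :
    ∃ h : H, ∑ y, ind (f (a * y) ≠ h * f y) ≤ 2 * δ * Fintype.card G := by
  set N : ℝ := (Fintype.card G : ℝ) with hN
  have hN0 : 0 < N := by simp [hN, Fintype.card_pos]
  let D : Bool → G → (Fin (n + 1) → Bool × G) → ℝ := fun b x q =>
    ind (applySign b (f (applySign b x)) * wordProd f q ≠ f (x * wordProd id q))
  have hD : ∑ p : Fin (n + 2) → Bool × G, ind (wordProd f p ≠ f (wordProd id p)) =
      ∑ b, ∑ x, ∑ q, D b x q := by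
    rw [sum_word_succ]
    refine Finset.sum_congr rfl fun b _ => ?_
    rw [← Equiv.sum_comp (applySignEquiv b)]
    simp [wordProd_cons, applySignEquiv, D]
  have hDa : ∑ b, ∑ x, ∑ q, D b (a * x) q = ∑ b, ∑ x, ∑ q, D b x q :=
    Finset.sum_congr rfl fun b _ => Equiv.sum_comp (Equiv.mulLeft a) fun x => ∑ q, D b x q
  have hc : (Fintype.card (Fin (n + 2) → Bool × G) : ℝ) =
      Fintype.card (Fin (n + 1) → Bool × G) * (2 * N) := by
    simp [hN, pow_succ]
  set C : ℝ := (Fintype.card (Fin (n + 1) → Bool × G) : ℝ) with hC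
  have hC0 : 0 < C := by simp [hC, Fintype.card_pos]
  obtain ⟨⟨b, x⟩, hbx⟩ : ∃ z : Bool × G, ∑ q, (D z.1 (a * z.2) q + D z.1 z.2 q) ≤ 2 * δ * C := by
    apply exists_le_of_sum_le_card_mul
    rw [Fintype.sum_prod_type]
    simp only [Finset.sum_add_distrib]
    rw [hDa, ← hD]
    simp only [Fintype.card_prod, Fintype.card_bool]
    push_cast
    rw [hc] at hδ
    linarith
  refine ⟨applySign b (f (applySign b (a * x))) * (applySign b (f (applySign b x)))⁻¹, ?_⟩
  set h := applySign b (f (applySign b (a * x))) * (applySign b (f (applySign b x)))⁻¹ with hh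
  have hle : ∑ q : Fin (n + 1) → Bool × G,
      ind (f (a * (x * wordProd id q)) ≠ h * f (x * wordProd id q)) ≤ 2 * δ * C := by
    refine le_trans (Finset.sum_le_sum fun q _ => ?_) hbx
    refine ind_le_add fun hne => ?_
    by_contra! hcon
    obtain ⟨h₁, h₂⟩ := hcon
    apply hne
    rw [← mul_assoc, ← h₁, ← h₂, hh]
    group
  have hu := card_mul_sum_wordProd (n := n) fun t => ind (f (a * (x * t)) ≠ h * f (x * t))
  have hx : ∑ t, ind (f (a * (x * t)) ≠ h * f (x * t)) = ∑ y, ind (f (a * y) ≠ h * f y) :=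
    Equiv.sum_comp (Equiv.mulLeft x) fun y => ind (f (a * y) ≠ h * f y)
  rw [hx, ← hN, ← hC] at hu
  refine le_of_mul_le_mul_left ?_ hC0
  rw [← hu]
  nlinarith

/-- If every left difference of `f` is nearly constant, then `f` is close to a right translate of
a homomorphism. -/
lemma exists_hom_translate (f : G → H) {η : ℝ} (hη : 3 * η < 1)
    (hf : ∀ a, ∃ h : H, ∑ y, ind (f (a * y) ≠ h * f y) ≤ η * Fintype.card G) :
    ∃ (φ : G →* H) (c : H), ∑ x, ind (f x ≠ φ x * c) ≤ η * Fintype.card G := by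
  choose φ hφ using hf
  have hN0 : (0 : ℝ) < Fintype.card G := by simp [Fintype.card_pos]
  have hmul : ∀ a b, φ (a * b) = φ a * φ b := by
    intro a b
    by_contra hne
    have h₁ := hφ (a * b)
    have h₂ := hφ b
    have h₃ := hφ a
    rw [← Equiv.sum_comp (Equiv.mulLeft b)] at h₃
    have : ∑ _y : G, (1 : ℝ) ≤ ∑ y, (ind (f (a * b * y) ≠ φ (a * b) * f y) +
        (ind (f (b * y) ≠ φ b * f y) + ind (f (a * (b * y)) ≠ φ a * f (b * y)))) := by
      refine Finset.sum_le_sum fun y _ => ?_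
      rw [← ind_of_true trivial]
      by_cases hy : f (a * b * y) = φ (a * b) * f y
      · have := ind_nonneg (f (a * b * y) ≠ φ (a * b) * f y)
        have := ind_le_add (P := True) (Q := f (b * y) ≠ φ b * f y)
          (R := f (a * (b * y)) ≠ φ a * f (b * y)) fun _ => by
            by_contra! hcon
            apply hne
            rw [← mul_left_inj (f y), ← hy, mul_assoc, hcon.2, hcon.1, mul_assoc]
        linarith
      · have := ind_nonneg (f (b * y) ≠ φ b * f y)
        have := ind_nonneg (f (a * (b * y)) ≠ φ a * f (b * y))
        rw [ind_of_true trivial, ind_of_true hy]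
        linarith
    simp only [Finset.sum_add_distrib, Finset.sum_const, Finset.card_univ, nsmul_eq_mul] at this
    simp only [Equiv.coe_mulLeft] at h₃
    nlinarith
  obtain ⟨y, hy⟩ : ∃ y, ∑ a, ind (f (a * y) ≠ φ a * f y) ≤ η * Fintype.card G := by
    apply exists_le_of_sum_le_card_mul
    rw [Finset.sum_comm]
    calc _ ≤ ∑ _a : G, η * (Fintype.card G : ℝ) := Finset.sum_le_sum fun a _ => hφ a
      _ = _ := by simp
  refine ⟨MonoidHom.mk' φ hmul, φ y⁻¹ * f y, ?_⟩
  rw [← Equiv.sum_comp (Equiv.mulRight y)]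
  refine le_of_eq_of_le (Finset.sum_congr rfl fun a _ => ?_) hy
  simp [← mul_assoc, ← hmul]

/-- A word of even length lands in a nontrivial translate of the graph of a homomorphism at most
half of the time. -/
lemma two_mul_sum_translate_le [Fintype H] (f : G → H) (φ : G →* H) {c : H} (hc : c ≠ 1) (k : ℕ) :
    2 * ∑ p : Fin (k + k) → Bool × G, ind (wordProd f p = φ (wordProd id p) * c) ≤
      Fintype.card (Fin (k + k) → Bool × G) := by
  let W := Fin k → Bool × G
  let X : W → W → G := fun q r => (wordProd id q)⁻¹ * wordProd id r
  let Y : W → W → H := fun q r => (wordProd f q)⁻¹ * wordProd f r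
  have hsum : ∑ p : Fin (k + k) → Bool × G, ind (wordProd f p = φ (wordProd id p) * c) =
      ∑ q, ∑ r, ind (Y q r = φ (X q r) * c) := by
    rw [sum_word_append, ← Equiv.sum_comp (invWord k)]
    simp only [wordProd_append, wordProd_invWord, X, Y]
    rfl
  let A : W → H := fun q => wordProd f q * (φ (wordProd id q))⁻¹
  let B : W → H := fun q => wordProd f q * c⁻¹ * (φ (wordProd id q))⁻¹
  have hAB : ∀ q r, A q = B r ↔ Y q r = φ (X q r) * c := by
    intro q r
    simp only [A, B, X, Y, map_mul, map_inv]
    constructor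
    · intro h
      rw [mul_inv_eq_iff_eq_mul] at h
      rw [h]; group
    · intro h
      rw [inv_mul_eq_iff_eq_mul] at h
      rw [h]; group
  have hAA : ∀ q r, A q = A r → Y q r = φ (X q r) := by
    intro q r h
    simp only [A, X, Y, map_mul, map_inv] at h ⊢
    rw [mul_inv_eq_iff_eq_mul] at h
    rw [h]; group
  have hBB : ∀ q r, B q = B r → Y q r = c⁻¹ * φ (X q r) * c := by
    intro q r h
    simp only [B, X, Y, map_mul, map_inv] at h ⊢
    rw [mul_inv_eq_iff_eq_mul, mul_inv_eq_iff_eq_mul] at h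
    rw [h]; group
  have hcs := two_mul_sum_ind_eq_le A B
  simp only [hAB] at hcs
  have hA : ∑ q, ∑ r, ind (A q = A r) + ∑ q, ∑ r, ind (Y q r = φ (X q r) * c) ≤
      ∑ _q : W, ∑ _r : W, (1 : ℝ) := by
    simp only [← Finset.sum_add_distrib]
    refine Finset.sum_le_sum fun q _ => Finset.sum_le_sum fun r _ => ?_
    rw [← ind_of_true trivial]
    refine ind_add_le (fun _ => trivial) (fun _ => trivial) fun h => hc ?_
    simpa using (hAA q r h.1).symm.trans h.2
  have hB : ∑ q, ∑ r, ind (B q = B r) + ∑ q, ∑ r, ind (Y q r = φ (X q r) * c) ≤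
      ∑ _q : W, ∑ _r : W, (1 : ℝ) := by
    simp only [← Finset.sum_add_distrib]
    refine Finset.sum_le_sum fun q _ => Finset.sum_le_sum fun r _ => ?_
    rw [← ind_of_true trivial]
    refine ind_add_le (fun _ => trivial) (fun _ => trivial) fun h => hc ?_
    simpa using (hBB q r h.1).symm.trans h.2
  have hone : ∑ _q : W, ∑ _r : W, (1 : ℝ) = Fintype.card (Fin (k + k) → Bool × G) := by
    simp [W, pow_add]
  rw [hsum]
  linarith

/-- A right translate of a homomorphism which is close to a function passing the signed test on
words of even length is the homomorphism itself. -/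
lemma translate_eq_one [Fintype H] (f : G → H) (φ : G →* H) (c : H) {k : ℕ} (hk : 1 ≤ k)
    {δ β : ℝ} (hβ : δ + β < 1 / 2)
    (hδ : ∑ p : Fin (k + k) → Bool × G, ind (wordProd f p ≠ f (wordProd id p)) ≤
      δ * Fintype.card (Fin (k + k) → Bool × G))
    (hf : ∑ x, ind (f x ≠ φ x * c) ≤ β * Fintype.card G) : c = 1 := by
  by_contra hc
  obtain ⟨n, hn⟩ : ∃ n, k + k = n + 1 := ⟨k + k - 1, by omega⟩
  have hN0 : (0 : ℝ) < Fintype.card G := by simp [Fintype.card_pos]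
  have h₁ := two_mul_sum_translate_le f φ hc k
  rw [hn] at h₁ hδ
  have hu := card_mul_sum_wordProd (n := n) fun x => ind (f x ≠ φ x * c)
  set C : ℝ := (Fintype.card (Fin (n + 1) → Bool × G) : ℝ) with hC
  have hC0 : 0 < C := by simp [hC, Fintype.card_pos]
  have h₂ : ∑ p : Fin (n + 1) → Bool × G, ind (f (wordProd id p) ≠ φ (wordProd id p) * c) ≤
      β * C := by
    refine le_of_mul_le_mul_left ?_ hN0
    rw [hu]
    nlinarith
  have h₃ : ∑ _p : Fin (n + 1) → Bool × G, (1 : ℝ) ≤ ∑ p : Fin (n + 1) → Bool × G,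
      (ind (wordProd f p = φ (wordProd id p) * c) + (ind (wordProd f p ≠ f (wordProd id p)) +
        ind (f (wordProd id p) ≠ φ (wordProd id p) * c))) := by
    refine Finset.sum_le_sum fun p _ => ?_
    by_cases hp : wordProd f p = φ (wordProd id p) * c
    · rw [ind_of_true hp]
      have := ind_nonneg (wordProd f p ≠ f (wordProd id p))
      have := ind_nonneg (f (wordProd id p) ≠ φ (wordProd id p) * c)
      linarith
    · rw [ind_of_false hp, zero_add, ← ind_of_true trivial]
      refine ind_le_add fun _ => ?_
      by_contra! hcon
      exact hp (hcon.1.trans hcon.2)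
  simp only [Finset.sum_add_distrib, Finset.sum_const, Finset.card_univ, nsmul_eq_mul, mul_one]
    at h₃
  nlinarith

lemma epsF_le_hdist (f : G → H) (φ : G →* H) : epsF f ≤ hdist f φ :=
  csInf_le ⟨0, by rintro _ ⟨h, rfl⟩; unfold hdist; positivity⟩ ⟨φ, rfl⟩

end HomomorphismTest

theorem stmt5 {G H : Type*} [Group G] [Group H] [Fintype G] [Fintype H]
    (k : ℕ) (hk : 1 ≤ k) (f : G → H) :
    min (epsF f / 2) (1 / 10) ≤
      (Nat.card {p : (Fin (2 * k) → Bool) × (Fin (2 * k) → G) //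
          sProd p.1 (fun i => f (p.2 i)) ≠ f (sProd p.1 p.2)} : ℝ) /
        (Nat.card ((Fin (2 * k) → Bool) × (Fin (2 * k) → G)) : ℝ) := by
  set δ : ℝ := (Nat.card {p : (Fin (2 * k) → Bool) × (Fin (2 * k) → G) //
          sProd p.1 (fun i => f (p.2 i)) ≠ f (sProd p.1 p.2)} : ℝ) /
        (Nat.card ((Fin (2 * k) → Bool) × (Fin (2 * k) → G)) : ℝ) with hδ
  by_contra! hlt
  obtain ⟨hε, h10⟩ := lt_min_iff.1 hlt
  have htest : ∑ p : Fin (k + k) → Bool × G, ind (wordProd f p ≠ f (wordProd id p)) ≤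
      δ * Fintype.card (Fin (k + k) → Bool × G) := by
    rw [← two_mul]
    have hcard : (Nat.card ((Fin (2 * k) → Bool) × (Fin (2 * k) → G)) : ℝ) =
        Fintype.card (Fin (2 * k) → Bool × G) := by
      rw [← Nat.card_eq_fintype_card, Nat.card_congr (Equiv.arrowProdEquivProdArrow _ _ _)]
    have hC0 : (0 : ℝ) < Fintype.card (Fin (2 * k) → Bool × G) := by
      exact_mod_cast Fintype.card_pos
    rw [hδ, ← sum_ind_eq_card, hcard, div_mul_cancel₀ _ hC0.ne',
      ← (Equiv.arrowProdEquivProdArrow (Fin (2 * k)) (fun _ => Bool) fun _ => G).sum_comp]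
    exact le_rfl
  obtain ⟨φ, c, hφ⟩ := exists_hom_translate f (η := 2 * δ) (by linarith) fun a => by
    obtain ⟨n, hn⟩ : ∃ n, k + k = n + 2 := ⟨k + k - 2, by omega⟩
    rw [hn] at htest
    exact exists_left_difference f htest a
  obtain rfl := translate_eq_one f φ c hk (by linarith) htest hφ
  have hN0 : (0 : ℝ) < Fintype.card G := by exact_mod_cast Fintype.card_pos
  have hdist_le : hdist f φ ≤ 2 * δ := by
    unfold hdist
    rw [div_le_iff₀ hN0, ← sum_ind_eq_card]
    simpa using hφ
  linarith [epsF_le_hdist f φ]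
end

section
/- Let (G,+) and (H,⊕) be finite groups, let k ≥ 1, let f : G → H be a function, and let μ be the fraction of tuples (σ,x) ∈ {+1,−1}^{2k} × G^{2k} for which ⊕_{i=1}^{2k} σ_i f(x_i) ≠ f(Σ_{i=1}^{2k} σ_i x_i). Suppose μ < 1/10 and g : G → H is a function such that for every a ∈ G the fraction of tuples in F_a whose vote equals g(a) is at least 1 − 2μ. Then g is a homomorphism, i.e., g(a + b) = g(a) ⊕ g(b) for all a, b ∈ G. -/
section Counting

open Finset

theorem card_filter_comp_of_card_fiber_eq {α β : Type*} [DecidableEq β] {S : Finset α}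
    {F : Finset β} {f : α → β} {N : ℕ} (hf : ∀ a ∈ S, f a ∈ F)
    (hN : ∀ b ∈ F, #{a ∈ S | f a = b} = N) (P : β → Prop) [DecidablePred P] :
    #{a ∈ S | P (f a)} = N * #{b ∈ F | P b} := by
  have hmaps : ∀ a ∈ ({a ∈ S | P (f a)} : Finset α), f a ∈ ({b ∈ F | P b} : Finset β) := by
    intro a ha
    simp only [mem_filter] at ha ⊢
    exact ⟨hf a ha.1, ha.2⟩
  rw [card_eq_sum_card_fiberwise hmaps, sum_const_nat (m := N), mul_comm]
  intro b hb
  rw [mem_filter] at hb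
  rw [← hN b hb.1, filter_filter]
  congr 1
  ext a
  simp only [mem_filter]
  constructor
  · rintro ⟨h, -, h'⟩
    exact ⟨h, h'⟩
  · rintro ⟨h, rfl⟩
    exact ⟨h, hb.2, rfl⟩

theorem exists_mem_and_and_of_card_lt {α : Type*} {S : Finset α} {P Q R : α → Prop}
    [DecidablePred P] [DecidablePred Q] [DecidablePred R]
    (h : 2 * #S < #{a ∈ S | P a} + #{a ∈ S | Q a} + #{a ∈ S | R a}) :
    ∃ a ∈ S, P a ∧ Q a ∧ R a := by
  by_contra! hne
  have hP : #{a ∈ S | P a} + #{a ∈ S | ¬ P a} = #S := card_filter_add_card_filter_not _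
  have hQ : #{a ∈ S | Q a} + #{a ∈ S | ¬ Q a} = #S := card_filter_add_card_filter_not _
  have hR : #{a ∈ S | R a} + #{a ∈ S | ¬ R a} = #S := card_filter_add_card_filter_not _
  classical
  have hS : S ⊆ {a ∈ S | ¬ P a} ∪ {a ∈ S | ¬ Q a} ∪ {a ∈ S | ¬ R a} := by
    intro a ha
    have := hne a ha
    simp only [mem_union, mem_filter]
    tauto
  have h₁ := card_le_card hS
  have h₂ := card_union_le ({a ∈ S | ¬ P a} ∪ {a ∈ S | ¬ Q a}) {a ∈ S | ¬ R a}
  have h₃ := card_union_le {a ∈ S | ¬ P a} {a ∈ S | ¬ Q a}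
  omega

/-- Halves `T` of tuples, with value `π` and vote `v`: if for every `a` more than two thirds of the
pairs of value `a` vote `g a`, then `g` is multiplicative. -/
theorem map_mul_of_pair_vote {G H T : Type*} [Group G] [Group H] [Fintype T]
    [DecidableEq G] [DecidableEq H] [DecidableEq T]
    {π : T → G} {v : T → H} {ι : T → T} (hι : Function.Involutive ι)
    (hπ : ∀ t, π (ι t) = (π t)⁻¹) (hv : ∀ t, v (ι t) = (v t)⁻¹)
    {N : ℕ} (hN : ∀ c, #{t | π t = c} = N) (hN0 : 0 < N) {g : G → H}
    (hg : ∀ a, 2 * #{p : T × T | π p.1 * π p.2 = a} <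
      3 * #{p ∈ ({p : T × T | π p.1 * π p.2 = a} : Finset (T × T)) | v p.1 * v p.2 = g a})
    (a b : G) : g (a * b) = g a * g b := by
  set F : G → Finset (T × T) := fun c => {p : T × T | π p.1 * π p.2 = c} with hF
  set S : Finset (T × T × T) :=
    {t : T × T × T | π t.1 * π t.2.1 = a ∧ (π t.2.1)⁻¹ * π t.2.2 = b} with hS
  have hcard : ∀ (c : G) (f : T × T × T → T × T), (∀ t ∈ S, f t ∈ F c) →
      (∀ p ∈ F c, #{t ∈ S | f t = p} = N) →
      2 * #S < 3 * #{t ∈ S | v (f t).1 * v (f t).2 = g c} := by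
    intro c f hf hfib
    have h₁ := card_filter_comp_of_card_fiber_eq hf hfib (fun _ => True)
    have h₂ := card_filter_comp_of_card_fiber_eq hf hfib (fun p => v p.1 * v p.2 = g c)
    simp only [filter_true] at h₁
    rw [h₁, h₂]
    have := Nat.mul_lt_mul_of_pos_left (hg c) hN0
    simp only [hF]
    linarith
  have h₁ := hcard a (fun t => (t.1, t.2.1)) (by simp +contextual [hS, hF]) (by
    rintro ⟨p, q⟩ hp
    rw [← hN (π q * b), ← card_image_of_injective (f := fun r => (p, q, r))
      ({r | π r = π q * b} : Finset T)
      (fun x y h => by simpa using h)]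
    congr 1
    ext ⟨x, y, z⟩
    simp only [hF, hS, mem_filter, mem_univ, true_and, mem_image, Prod.mk.injEq] at hp ⊢
    constructor
    · rintro ⟨⟨h, h'⟩, rfl, rfl⟩
      exact ⟨z, by rw [← h']; group, rfl, rfl, rfl⟩
    · rintro ⟨r, h, rfl, rfl, rfl⟩
      exact ⟨⟨hp, by rw [h]; group⟩, rfl, rfl⟩)
  have h₂ := hcard b (fun t => (ι t.2.1, t.2.2)) (by simp +contextual [hS, hF, hπ]) (by
    rintro ⟨q, r⟩ hp
    rw [← hN (a * π q), ← card_image_of_injective (f := fun p => (p, ι q, r))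
      ({p | π p = a * π q} : Finset T)
      (fun x y h => by simpa using h)]
    congr 1
    ext ⟨x, y, z⟩
    simp only [hF, hS, mem_filter, mem_univ, true_and, mem_image, Prod.mk.injEq] at hp ⊢
    constructor
    · rintro ⟨⟨h, h'⟩, rfl, rfl⟩
      exact ⟨x, by rw [← h, hπ]; group, rfl, hι y, rfl⟩
    · rintro ⟨p, h, rfl, rfl, rfl⟩
      exact ⟨⟨by rw [h, hπ]; group, by rw [hπ, inv_inv, hp]⟩, hι q, rfl⟩)
  have h₃ := hcard (a * b) (fun t => (t.1, t.2.2)) (by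
      simp only [hS, hF, mem_filter, mem_univ, true_and]
      rintro t ⟨rfl, rfl⟩
      group) (by
    rintro ⟨p, r⟩ hp
    rw [← hN ((π p)⁻¹ * a), ← card_image_of_injective (f := fun q => (p, q, r))
      ({q | π q = (π p)⁻¹ * a} : Finset T)
      (fun x y h => by simpa using h)]
    congr 1
    ext ⟨x, y, z⟩
    simp only [hF, hS, mem_filter, mem_univ, true_and, mem_image, Prod.mk.injEq] at hp ⊢
    constructor
    · rintro ⟨⟨h, h'⟩, rfl, rfl⟩
      exact ⟨y, by rw [← h]; group, rfl, rfl, rfl⟩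
    · rintro ⟨q, h, rfl, rfl, rfl⟩
      refine ⟨⟨by rw [h]; group, ?_⟩, rfl, rfl⟩
      rw [h, mul_inv_rev, inv_inv, mul_assoc, hp, inv_mul_cancel_left])
  obtain ⟨t, -, hP, hQ, hR⟩ := exists_mem_and_and_of_card_lt
    (S := S) (P := fun t => v t.1 * v t.2.1 = g a) (Q := fun t => v (ι t.2.1) * v t.2.2 = g b)
    (R := fun t => v t.1 * v t.2.2 = g (a * b)) (by dsimp only at h₁ h₂ h₃; omega)
  rw [← hP, ← hQ, ← hR, hv]
  group

end Counting

theorem applySign_not_s9 {G : Type*} [Group G] (s : Bool) (x : G) :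
    applySign (!s) x = (applySign s x)⁻¹ := by
  cases s <;> simp [applySign]

theorem sProd_append {G : Type*} [Group G] {m n : ℕ} (σ : Fin m → Bool) (τ : Fin n → Bool)
    (x : Fin m → G) (y : Fin n → G) :
    sProd (Fin.append σ τ) (Fin.append x y) = sProd σ x * sProd τ y := by
  simp [sProd, List.ofFn_add]

theorem sProd_rev {G : Type*} [Group G] {k : ℕ} (σ : Fin k → Bool) (x : Fin k → G) :
    sProd (fun i => !σ i.rev) (fun i => x i.rev) = (sProd σ x)⁻¹ := by
  simp only [sProd, applySign_not_s9, List.prod_inv_reverse, List.map_ofFn]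
  congr 1
  apply List.ext_getElem <;> simp [Fin.rev, Nat.sub_sub, add_comm]

/-- Change the first entry of `x` so as to multiply the signed product on the left by `d`. -/
def shiftHead {G : Type*} [Group G] {m : ℕ} (d : G)
    (p : (Fin (m + 1) → Bool) × (Fin (m + 1) → G)) :
    (Fin (m + 1) → Bool) × (Fin (m + 1) → G) :=
  (p.1, Fin.cons (if p.1 0 then d * p.2 0 else p.2 0 * d⁻¹) (Fin.tail p.2))

theorem sProd_shiftHead {G : Type*} [Group G] {m : ℕ} (d : G)
    (p : (Fin (m + 1) → Bool) × (Fin (m + 1) → G)) :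
    sProd (shiftHead d p).1 (shiftHead d p).2 = d * sProd p.1 p.2 := by
  cases h : p.1 0 <;> simp [sProd, shiftHead, applySign, h, Fin.tail, mul_assoc]

theorem shiftHead_injective {G : Type*} [Group G] {m : ℕ} (d : G) :
    Function.Injective (shiftHead (m := m) d) := by
  rintro ⟨σ, x⟩ ⟨τ, y⟩ h
  simp only [shiftHead, Prod.mk.injEq, Fin.cons_inj] at h
  obtain ⟨rfl, h₀, h₁⟩ := h
  have : x 0 = y 0 := by
    cases hs : σ 0 <;> simpa [hs] using h₀
  rw [← Fin.cons_self_tail x, ← Fin.cons_self_tail y, this, h₁]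

open Finset in
theorem card_sProd_fiber {G : Type*} [Group G] [Fintype G] [DecidableEq G] {k : ℕ} (hk : 1 ≤ k)
    (c : G) :
    #{p : (Fin k → Bool) × (Fin k → G) | sProd p.1 p.2 = c} =
      #{p : (Fin k → Bool) × (Fin k → G) | sProd p.1 p.2 = 1} := by
  obtain ⟨m, rfl⟩ := Nat.exists_eq_add_of_le' hk
  have key : ∀ a b : G, #{p : (Fin (m + 1) → Bool) × (Fin (m + 1) → G) | sProd p.1 p.2 = a} ≤
      #{p : (Fin (m + 1) → Bool) × (Fin (m + 1) → G) | sProd p.1 p.2 = b} := fun a b =>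
    card_le_card_of_injOn (shiftHead (b * a⁻¹))
      (fun p hp => by
        simp only [coe_filter, mem_univ, true_and, Set.mem_ofPred_eq] at hp ⊢
        rw [sProd_shiftHead, hp, inv_mul_cancel_right])
      (shiftHead_injective _).injOn
  exact le_antisymm (key _ _) (key _ _)

/-- Concatenation of two signed tuples of the same length. -/
def pairEquiv (G : Type*) (k : ℕ) :
    ((Fin k → Bool) × (Fin k → G)) × ((Fin k → Bool) × (Fin k → G)) ≃
      (Fin (k + k) → Bool) × (Fin (k + k) → G) :=
  (Equiv.prodProdProdComm _ _ _ _).trans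
    (Equiv.prodCongr (Fin.appendEquiv k k) (Fin.appendEquiv k k))

theorem sProd_pairEquiv {G K : Type*} [Group K] {k : ℕ} (f : G → K)
    (p : ((Fin k → Bool) × (Fin k → G)) × ((Fin k → Bool) × (Fin k → G))) :
    sProd (pairEquiv G k p).1 (fun i => f ((pairEquiv G k p).2 i)) =
      sProd p.1.1 (fun i => f (p.1.2 i)) * sProd p.2.1 (fun i => f (p.2.2 i)) := by
  rw [← sProd_append]
  congr 1
  funext i
  refine Fin.addCases (fun j => ?_) (fun j => ?_) i
  · change f (Fin.append _ _ _) = Fin.append _ _ _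
    rw [Fin.append_left, Fin.append_left]
  · change f (Fin.append _ _ _) = Fin.append _ _ _
    rw [Fin.append_right, Fin.append_right]

theorem two_mul_lt_three_mul_of_le_div {μ : ℝ} (hμ : μ < 1 / 10) {m n : ℕ}
    (h : 1 - 2 * μ ≤ (n : ℝ) / m) : 2 * m < 3 * n := by
  rcases Nat.eq_zero_or_pos m with rfl | hm
  · rw [Nat.cast_zero, div_zero] at h
    linarith
  · have hm' : (0 : ℝ) < m := by exact_mod_cast hm
    rw [le_div_iff₀ hm'] at h
    rify
    nlinarith

theorem stmt9 {G H : Type*} [Group G] [Group H] [Fintype G] [Fintype H]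
    (k : ℕ) (hk : 1 ≤ k) (f : G → H) (μ : ℝ)
    (hμ : μ = (Nat.card {p : (Fin (2 * k) → Bool) × (Fin (2 * k) → G) //
          sProd p.1 (fun i => f (p.2 i)) ≠ f (sProd p.1 p.2)} : ℝ) /
        (Nat.card ((Fin (2 * k) → Bool) × (Fin (2 * k) → G)) : ℝ))
    (hsmall : μ < 1 / 10) (g : G → H)
    (hmaj : ∀ a : G,
      1 - 2 * μ ≤
        (Nat.card {p : (Fin (2 * k) → Bool) × (Fin (2 * k) → G) //
            sProd p.1 p.2 = a ∧ sProd p.1 (fun i => f (p.2 i)) = g a} : ℝ) /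
          (Nat.card {p : (Fin (2 * k) → Bool) × (Fin (2 * k) → G) //
            sProd p.1 p.2 = a} : ℝ)) :
    ∀ a b : G, g (a * b) = g a * g b := by
  classical
  clear hμ
  rw [two_mul k] at hmaj
  refine map_mul_of_pair_vote (T := (Fin k → Bool) × (Fin k → G))
    (π := fun p => sProd p.1 p.2) (v := fun p => sProd p.1 (fun i => f (p.2 i)))
    (ι := fun p => (fun i => !p.1 i.rev, fun i => p.2 i.rev))
    (fun p => by simp) (fun p => sProd_rev _ _) (fun p => sProd_rev p.1 (fun i => f (p.2 i)))
    (card_sProd_fiber hk) ?_ fun a => ?_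
  · exact Finset.card_pos.mpr ⟨(fun _ => true, fun _ => 1),
      Finset.mem_filter.mpr ⟨Finset.mem_univ _, by simp [sProd, applySign]⟩⟩
  · have h := hmaj a
    have hid := sProd_pairEquiv (k := k) (id : G → G)
    simp only [id] at hid
    have e₁ := Nat.card_congr ((pairEquiv G k).subtypeEquiv
      (p := fun p => sProd p.1.1 p.1.2 * sProd p.2.1 p.2.2 = a)
      (q := fun p => sProd p.1 p.2 = a) fun p => by rw [hid p])
    have e₂ := Nat.card_congr ((pairEquiv G k).subtypeEquiv
      (p := fun p => sProd p.1.1 p.1.2 * sProd p.2.1 p.2.2 = a ∧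
        sProd p.1.1 (fun i => f (p.1.2 i)) * sProd p.2.1 (fun i => f (p.2.2 i)) = g a)
      (q := fun p => sProd p.1 p.2 = a ∧ sProd p.1 (fun i => f (p.2 i)) = g a) fun p => by
        rw [hid p, sProd_pairEquiv f p])
    rw [← e₁, ← e₂, Nat.card_eq_fintype_card, Nat.card_eq_fintype_card, Fintype.card_subtype,
      Fintype.card_subtype] at h
    rw [Finset.filter_filter]
    exact two_mul_lt_three_mul_of_le_div hsmall h
end
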